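/- Let R be a commutative ring equipped with an involutive ring automorphism r ↦ r̄, let n ≥ 1, let a, b, c ∈ R^n, and let λ, μ ∈ R satisfy λ·λ̄ = 1 and μ·μ̄ = 1. Set A = circ_λ(a), B = circ_λ(b), C = circ_μ(c), let J be the n×n exchange matrix, and let X be the 2n×2n block matrix X = [[−A^T·C·J, −B̄], [B^T·C·J, −Ā]]. Then X·(X̄)^T = −I_{2n} if and only if the following hold: Θ(a,ā,0) + Θ(b,b̄,0) = −1; Θ(a,ā,j)[λ̄] + Θ(b,b̄,j)[λ̄] = 0 for every j ∈ {1,…,⌊n/2⌋}; Θ(c,c̄,0) = 1; and Θ(c,c̄,j)[μ̄] = 0 for every j ∈ {1,…,⌊n/2⌋}. -/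

import Mathlib

open Matrix

/-- The mapping Θ(x,y,j)[λ] = Σ_{i=0}^{n−j−1} x_{[i+j]_n}·y_i + λ·Σ_{i=n−j}^{n−1} x_{[i+j]_n}·y_i. -/
def Theta {R : Type*} [CommRing R] (n : ℕ) (x y : ℕ → R) (j : ℕ) (l : R) : R :=
  (∑ i ∈ Finset.range (n - j), x ((i + j) % n) * y i)
    + l * ∑ i ∈ Finset.Ico (n - j) n, x ((i + j) % n) * y i

/-- The λ-circulant matrix generated by `a`. -/
def circ {R : Type*} [CommRing R] (n : ℕ) (l : R) (a : ℕ → R) : Matrix (Fin n) (Fin n) R :=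
  Matrix.of fun i j => if (i : ℕ) ≤ (j : ℕ) then a ((j : ℕ) - i) else l * a (n + j - i)

/-- The n×n exchange matrix. -/
def exch (R : Type*) [CommRing R] (n : ℕ) : Matrix (Fin n) (Fin n) R :=
  Matrix.of fun i j => if (i : ℕ) + (j : ℕ) = n - 1 then 1 else 0

/-- The basic shift matrix. -/
def shiftP {R : Type*} [CommRing R] (n : ℕ) (l : R) : Matrix (Fin n) (Fin n) R :=
  Matrix.of fun i j => if (i : ℕ) + 1 = (j : ℕ) then 1
    else if (i : ℕ) + 1 = n ∧ (j : ℕ) = 0 then l else 0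

section aux
variable {R : Type*} [CommRing R]

theorem shiftP_mul_lt (n : ℕ) (l : R) (M : Matrix (Fin n) (Fin n) R) (i : ℕ) (h : i + 1 < n)
    (j : Fin n) : (shiftP n l * M) ⟨i, by omega⟩ j = M ⟨i + 1, h⟩ j := by
  rw [Matrix.mul_apply, Finset.sum_eq_single ⟨i + 1, h⟩]
  · simp [shiftP]
  · intro k _ hk
    have h1 : i + 1 ≠ (k : ℕ) := fun e => hk (Fin.ext e.symm)
    have h2 : i + 1 ≠ n := by omega
    simp [shiftP, h1, h2]
  · simp

theorem shiftP_mul_last (n : ℕ) (l : R) (M : Matrix (Fin n) (Fin n) R) (i : ℕ) (h : i + 1 = n)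
    (j : Fin n) : (shiftP n l * M) ⟨i, by omega⟩ j = l * M ⟨0, by omega⟩ j := by
  rw [Matrix.mul_apply, Finset.sum_eq_single ⟨0, by omega⟩]
  · have h0 : n ≠ 0 := by omega
    simp [shiftP, h, h0]
  · intro k _ hk
    have h1 : i + 1 ≠ (k : ℕ) := by have := k.2; omega
    have h2 : (k : ℕ) ≠ 0 := fun e => hk (Fin.ext e)
    simp only [shiftP, Matrix.of_apply, if_neg h1, h2, and_false, if_false, zero_mul]
  · simp

theorem mul_shiftP_succ (n : ℕ) (l : R) (M : Matrix (Fin n) (Fin n) R) (j : ℕ) (h : j + 1 < n)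
    (i : Fin n) : (M * shiftP n l) i ⟨j + 1, h⟩ = M i ⟨j, by omega⟩ := by
  rw [Matrix.mul_apply, Finset.sum_eq_single ⟨j, by omega⟩]
  · simp [shiftP]
  · intro k _ hk
    have h1 : (k : ℕ) ≠ j := fun e => hk (Fin.ext e)
    simp [shiftP, h1]
  · simp

theorem mul_shiftP_zero (n : ℕ) (l : R) (M : Matrix (Fin n) (Fin n) R) (j : ℕ) (h : j + 1 = n)
    (i : Fin n) : (M * shiftP n l) i ⟨0, by omega⟩ = l * M i ⟨j, by omega⟩ := by
  rw [Matrix.mul_apply, Finset.sum_eq_single ⟨j, by omega⟩]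
  · have h0 : n ≠ 0 := by omega
    simp [shiftP, h, h0, mul_comm]
  · intro k _ hk
    have h1 : (k : ℕ) ≠ j := fun e => hk (Fin.ext e)
    have h2 : (k : ℕ) + 1 ≠ n := by omega
    simp [shiftP, h2]
  · simp

theorem circ_comm_shiftP (n : ℕ) (l : R) (a : ℕ → R) :
    shiftP n l * circ n l a = circ n l a * shiftP n l := by
  ext ⟨i, hi⟩ ⟨j, hj⟩
  rcases Nat.lt_or_ge (i + 1) n with h | h
  · rw [shiftP_mul_lt n l _ i h]
    rcases j with _ | j
    · rw [mul_shiftP_zero n l _ (n - 1) (by omega)]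
      have h1 : i ≤ n - 1 := by omega
      have h2 : n - (i + 1) = n - 1 - i := by omega
      simp [circ, h1, h2]
    · rw [mul_shiftP_succ n l _ j hj]
      have h2 : n + (j + 1) - (i + 1) = n + j - i := by omega
      simp [circ, h2]
  · rw [shiftP_mul_last n l _ i (by omega)]
    rcases j with _ | j
    · rw [mul_shiftP_zero n l _ (n - 1) (by omega)]
      have h1 : n - 1 = i := by omega
      simp [circ, h1]
    · rw [mul_shiftP_succ n l _ j hj]
      have h1 : ¬ i ≤ j := by omega
      have h2 : n + j - i = j + 1 := by omega
      simp [circ, h1, h2]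

theorem eq_zero_of_row (n : ℕ) (hn : 0 < n) (l : R) (M : Matrix (Fin n) (Fin n) R)
    (hM : shiftP n l * M = M * shiftP n l) (h0 : ∀ j, M ⟨0, hn⟩ j = 0) : M = 0 := by
  have key : ∀ i (hi : i < n), ∀ j, M ⟨i, hi⟩ j = 0 := by
    intro i
    induction i with
    | zero => intro _ j; exact h0 j
    | succ i ih =>
      intro hi j
      rw [← shiftP_mul_lt n l M i hi j, hM, Matrix.mul_apply]
      exact Finset.sum_eq_zero fun k _ => by rw [ih (by omega), zero_mul]
  ext ⟨i, hi⟩ j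
  exact key i hi j

theorem eq_circ (n : ℕ) (hn : 0 < n) (l : R) (M : Matrix (Fin n) (Fin n) R)
    (hM : shiftP n l * M = M * shiftP n l) :
    M = circ n l (fun k => if h : k < n then M ⟨0, hn⟩ ⟨k, h⟩ else 0) := by
  rw [← sub_eq_zero]
  apply eq_zero_of_row n hn l
  · rw [mul_sub, sub_mul, hM, circ_comm_shiftP]
  · intro j
    rw [Matrix.sub_apply]
    simp only [circ, Matrix.of_apply, Nat.zero_le, if_true, Nat.sub_zero, Fin.is_lt, dif_pos, Fin.eta, sub_self]

theorem shiftP_pow_row (n : ℕ) (hn : 0 < n) (l : R) (k : ℕ) (hk : k < n) (j : Fin n) :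
    (shiftP n l ^ k) ⟨0, hn⟩ j = if (j : ℕ) = k then 1 else 0 := by
  induction k generalizing j with
  | zero =>
    rw [pow_zero, Matrix.one_apply]
    simp [Fin.ext_iff, eq_comm]
  | succ k ih =>
    rw [pow_succ]
    obtain ⟨j, hj⟩ := j
    rcases j with _ | j
    · rw [mul_shiftP_zero n l _ (n - 1) (by omega), ih (by omega)]
      have : n - 1 ≠ k := by omega
      simp [this]
    · rw [mul_shiftP_succ n l _ j hj, ih (by omega)]
      simp

theorem eq_sum_pow (n : ℕ) (hn : 0 < n) (l : R) (M : Matrix (Fin n) (Fin n) R)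
    (hM : shiftP n l * M = M * shiftP n l) :
    M = ∑ k : Fin n, M ⟨0, hn⟩ k • shiftP n l ^ (k : ℕ) := by
  rw [← sub_eq_zero]
  apply eq_zero_of_row n hn l
  · rw [mul_sub, sub_mul, hM, Finset.mul_sum, Finset.sum_mul]
    congr 1
    refine Finset.sum_congr rfl fun k _ => ?_
    rw [mul_smul_comm, smul_mul_assoc, ← pow_succ, ← pow_succ']
  · intro j
    rw [Matrix.sub_apply, Matrix.sum_apply, Finset.sum_eq_single j]
    · simp [shiftP_pow_row n hn l j j.2]
    · intro k _ hk
      have : (j : ℕ) ≠ k := fun e => hk (Fin.ext e.symm)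
      simp [shiftP_pow_row n hn l k k.2, this]
    · simp

theorem comm_of_comm (n : ℕ) (hn : 0 < n) (l : R) (M N : Matrix (Fin n) (Fin n) R)
    (hM : Commute (shiftP n l) M) (hN : Commute (shiftP n l) N) : Commute M N := by
  rw [eq_sum_pow n hn l N hN]
  refine Commute.sum_right _ _ _ fun k _ => ?_
  exact ((hM.symm.pow_right _)).smul_right _

theorem shiftP_mul_star (n : ℕ) (σ : R ≃+* R) (l : R) (hl : l * σ l = 1) :
    shiftP n l * ((shiftP n l).map σ)ᵀ = 1 := by
  ext ⟨i, hi⟩ ⟨j, hj⟩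
  rw [Matrix.one_apply]
  rcases Nat.lt_or_ge (i + 1) n with h | h
  · rw [shiftP_mul_lt n l _ i h]
    by_cases e : i = j
    · subst e; simp [shiftP]
    · have : j ≠ i := fun h => e h.symm
      simp [shiftP, e, this]
  · rw [shiftP_mul_last n l _ i (by omega)]
    by_cases e : i = j
    · subst e
      have : i + 1 = n := by omega
      have h0 : n ≠ 0 := by omega
      simp [shiftP, this, h0, hl]
    · have : j + 1 ≠ n := by omega
      simp [shiftP, e, this]

theorem sstar_mul (n : ℕ) (σ : R ≃+* R) (M N : Matrix (Fin n) (Fin n) R) :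
    ((M * N).map σ)ᵀ = (N.map σ)ᵀ * (M.map σ)ᵀ := by
  rw [Matrix.map_mul, Matrix.transpose_mul]

theorem comm_star (n : ℕ) (σ : R ≃+* R) (l : R) (hl : l * σ l = 1)
    (M : Matrix (Fin n) (Fin n) R) (hM : Commute (shiftP n l) M) :
    Commute (shiftP n l) (M.map σ)ᵀ := by
  have h1 := shiftP_mul_star n σ l hl
  have h2 := mul_eq_one_comm.mp h1
  have h3 := congrArg (fun Z => (Z.map σ)ᵀ) hM.eq
  simp only [sstar_mul] at h3
  set P := shiftP n l
  set Q := (P.map σ)ᵀ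
  set S := (M.map σ)ᵀ
  calc P * S = P * (S * Q) * P := by rw [mul_assoc, mul_assoc, h2, mul_one]
    _ = S * P := by rw [h3, ← mul_assoc, h1, one_mul]

theorem circ_row_theta (n : ℕ) (hn : 0 < n) (σ : R ≃+* R) (l : R) (a : ℕ → R) (j : ℕ)
    (hj : j < n) :
    (circ n l a * ((circ n l a).map σ)ᵀ) ⟨0, hn⟩ ⟨j, hj⟩
      = Theta n a (fun i => σ (a i)) j (σ l) := by
  have e : (circ n l a * ((circ n l a).map σ)ᵀ) ⟨0, hn⟩ ⟨j, hj⟩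
      = ∑ k : Fin n, (fun k : ℕ => a k * σ (if j ≤ k then a (k - j) else l * a (n + k - j))) k := by
    rw [Matrix.mul_apply]
    refine Finset.sum_congr rfl fun k _ => ?_
    simp only [circ, Matrix.of_apply, Matrix.transpose_apply, Matrix.map_apply, Nat.zero_le, if_true, Nat.sub_zero]
  rw [e, Fin.sum_univ_eq_sum_range
    (fun k : ℕ => a k * σ (if j ≤ k then a (k - j) else l * a (n + k - j))),
    ← Finset.sum_range_add_sum_Ico _ hj.le, add_comm, Theta]
  congr 1
  · rw [Finset.sum_Ico_eq_sum_range]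
    refine Finset.sum_congr rfl fun i hi => ?_
    rw [Finset.mem_range] at hi
    rw [Nat.mod_eq_of_lt (by omega : i + j < n)]
    simp [add_comm]
  · rw [Finset.sum_Ico_eq_sum_range, Finset.mul_sum]
    have : n - (n - j) = j := by omega
    rw [this]
    refine Finset.sum_congr rfl fun i hi => ?_
    rw [Finset.mem_range] at hi
    have h1 : n - j + i + j = i + n := by omega
    have h2 : ¬ j ≤ i := by omega
    have h3 : n + i - j = n - j + i := by omega
    rw [h1, Nat.add_mod_right, Nat.mod_eq_of_lt (by omega : i < n), if_neg h2, h3, map_mul]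
    ring

theorem herm_zero_iff (n : ℕ) (hn : 0 < n) (σ : R ≃+* R) (l : R) (hl : l * σ l = 1)
    (H : Matrix (Fin n) (Fin n) R) (hP : Commute (shiftP n l) H) (hH : (H.map σ)ᵀ = H) :
    H = 0 ↔ (H ⟨0, hn⟩ ⟨0, hn⟩ = 0 ∧
      ∀ j, 1 ≤ j → (h : j ≤ n / 2) → H ⟨0, hn⟩ ⟨j, by omega⟩ = 0) := by
  constructor
  · intro h; simp [h]
  · rintro ⟨h0, h1⟩
    apply eq_zero_of_row n hn l H hP
    rintro ⟨j, hj⟩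
    rcases Nat.eq_zero_or_pos j with rfl | hj0
    · exact h0
    by_cases hj2 : j ≤ n / 2
    · exact h1 j hj0 hj2
    have h2 := h1 (n - j) (by omega) (by omega)
    have h3 : H ⟨n - j, by omega⟩ ⟨0, hn⟩ = 0 := by
      rw [← hH, Matrix.transpose_apply, Matrix.map_apply, h2, map_zero]
    have h4 := congrFun (congrFun (eq_circ n hn l H hP) ⟨n - j, by omega⟩) ⟨0, hn⟩
    have h5 : ¬ n - j = 0 := by omega
    have h6 : n - (n - j) = j := by omega
    rw [h3] at h4
    simp [circ, h5, h6, hj] at h4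
    calc H ⟨0, hn⟩ ⟨j, hj⟩ = (l * σ l) * H ⟨0, hn⟩ ⟨j, hj⟩ := by rw [hl, one_mul]
      _ = σ l * (l * H ⟨0, hn⟩ ⟨j, hj⟩) := by ring
      _ = 0 := by rw [← h4, mul_zero]

theorem exch_star (n : ℕ) (σ : R ≃+* R) : ((exch R n).map σ)ᵀ = exch R n := by
  ext i j
  simp only [exch, Matrix.transpose_apply, Matrix.map_apply, Matrix.of_apply, add_comm (j : ℕ)]
  split_ifs <;> simp

theorem exch_mul (n : ℕ) : exch R n * exch R n = 1 := by
  ext i j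
  have hi := i.2
  have hj := j.2
  rw [Matrix.mul_apply, Finset.sum_eq_single ⟨n - 1 - i, by omega⟩, Matrix.one_apply]
  · have h1 : (i : ℕ) + (n - 1 - i) = n - 1 := by omega
    by_cases e : i = j
    · subst e
      have h2 : n - 1 - (i : ℕ) + i = n - 1 := by omega
      simp [exch, h1, h2]
    · have h2 : ¬ (n - 1 - (i : ℕ) + j = n - 1) := by
        intro h; apply e; ext; omega
      simp [exch, h2, e]
  · intro k _ hk
    have : ¬ ((i : ℕ) + k = n - 1) := by
      intro h; apply hk; ext; simp; omega
    simp [exch, this]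
  · simp

theorem sstar_star (n : ℕ) (σ : R ≃+* R) (hσ : Function.Involutive σ)
    (M : Matrix (Fin n) (Fin n) R) : (((M.map σ)ᵀ).map σ)ᵀ = M := by
  ext i j
  simp [hσ (M i j)]

theorem map_map_inv (n : ℕ) (σ : R ≃+* R) (hσ : Function.Involutive σ)
    (M : Matrix (Fin n) (Fin n) R) : (M.map σ).map σ = M := by
  ext i j
  simp [hσ (M i j)]

theorem block_iff (σ : R ≃+* R) (hσ : Function.Involutive σ)
    (n : ℕ) (A B C J : Matrix (Fin n) (Fin n) R)
    (hAA : Commute (A.map σ)ᵀ A) (hBA : Commute (A.map σ)ᵀ B)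
    (hBB : Commute (B.map σ)ᵀ B)
    (hJ : (J.map σ)ᵀ = J) (hJJ : J * J = 1)
    (X : Matrix (Fin n ⊕ Fin n) (Fin n ⊕ Fin n) R)
    (hX : X = Matrix.fromBlocks (-(Aᵀ * C * J)) (-(B.map σ)) (Bᵀ * C * J) (-(A.map σ))) :
    X * (X.map σ)ᵀ = -1 ↔ (A * (A.map σ)ᵀ + B * (B.map σ)ᵀ = -1 ∧ C * (C.map σ)ᵀ = 1) := by
  have cAA : A.map σ * Aᵀ = Aᵀ * A.map σ := by
    have := congrArg Matrix.transpose hAA.eq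
    simpa [Matrix.transpose_mul] using this.symm
  have cBB : B.map σ * Bᵀ = Bᵀ * B.map σ := by
    have := congrArg Matrix.transpose hBB.eq
    simpa [Matrix.transpose_mul] using this.symm
  have cAB : A.map σ * Bᵀ = Bᵀ * A.map σ := by
    have := congrArg Matrix.transpose hBA.eq
    simpa [Matrix.transpose_mul] using this.symm
  have cBA : B.map σ * Aᵀ = Aᵀ * B.map σ := by
    have := congrArg (fun Z => Z.map σ) cAB
    simp only [Matrix.map_mul, Matrix.transpose_map, map_map_inv n σ hσ] at this
    have := congrArg Matrix.transpose this
    simpa [Matrix.transpose_mul, Matrix.transpose_map] using this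
  have hS : A * (A.map σ)ᵀ + B * (B.map σ)ᵀ = -1 ↔ Aᵀ * A.map σ + Bᵀ * B.map σ = -1 := by
    rw [← cAA, ← cBB, ← Matrix.transpose_inj]
    simp [Matrix.transpose_mul]
  have hXs : (X.map σ)ᵀ = Matrix.fromBlocks (-(J * (C.map σ)ᵀ * A.map σ)) (J * (C.map σ)ᵀ * B.map σ)
      (-Bᵀ) (-Aᵀ) := by
    have hneg : ∀ M : Matrix (Fin n) (Fin n) R, (-M).map σ = -(M.map σ) := by
      intro M; ext i j; simp
    rw [hX, Matrix.fromBlocks_map, Matrix.fromBlocks_transpose]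
    simp only [hneg, Matrix.map_mul, Matrix.transpose_neg, Matrix.transpose_mul, hJ,
      map_map_inv n σ hσ, Matrix.transpose_map, Matrix.transpose_transpose, mul_assoc]
  have hone : (-1 : Matrix (Fin n ⊕ Fin n) (Fin n ⊕ Fin n) R)
      = Matrix.fromBlocks (-1) 0 0 (-1) := by
    rw [← Matrix.fromBlocks_one, Matrix.fromBlocks_neg]; simp
  rw [hS]
  set Cs := (C.map σ)ᵀ
  set Ab := A.map σ
  set Bb := B.map σ
  constructor
  · intro h
    have h' : (X.map σ)ᵀ * X = -1 := by
      have : X * (-(X.map σ)ᵀ) = 1 := by rw [mul_neg, h, neg_neg]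
      have := mul_eq_one_comm.mp this
      rw [← neg_eq_iff_eq_neg, ← neg_mul]; exact this
    rw [hXs, hX, Matrix.fromBlocks_multiply, hone, Matrix.fromBlocks_inj] at h'
    obtain ⟨h11, -, -, h22⟩ := h'
    have hs : Aᵀ * Ab + Bᵀ * Bb = -1 := by
      rw [← h22]; noncomm_ring
    refine ⟨hs, ?_⟩
    have h1 : J * Cs * (Aᵀ * Ab + Bᵀ * Bb) * C * J = -1 := by
      rw [← h11, ← cAA, ← cBB]; noncomm_ring
    rw [hs] at h1
    have h2 : (J * Cs) * (C * J) = 1 := by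
      have : (J * Cs) * (C * J) = - (J * Cs * (-1) * C * J) := by noncomm_ring
      rw [this, h1, neg_neg]
    have h3 := mul_eq_one_comm.mp h2
    calc C * Cs = C * (J * J) * Cs := by rw [hJJ, mul_one]
      _ = C * J * (J * Cs) := by noncomm_ring
      _ = 1 := h3
  · rintro ⟨hs, hc⟩
    have k : ∀ U V : Matrix (Fin n) (Fin n) R, U * C * J * (J * Cs * V) = U * V := by
      intro U V
      calc U * C * J * (J * Cs * V) = U * (C * (J * J) * Cs) * V := by noncomm_ring
        _ = U * V := by rw [hJJ, mul_one, hc, mul_one]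
    rw [hXs, hX, Matrix.fromBlocks_multiply, hone, Matrix.fromBlocks_inj]
    simp only [neg_mul, mul_neg, neg_neg, k]
    refine ⟨?_, ?_, ?_, ?_⟩
    · rw [cBB, hs]
    · rw [cBA]; simp
    · rw [cAB]; simp
    · rw [cAA, add_comm, hs]

end aux

theorem stmt7 {R : Type*} [CommRing R] (σ : R ≃+* R) (hσ : Function.Involutive σ)
    (n : ℕ) (hn : 1 ≤ n) (a b c : ℕ → R) (l m : R) (hl : l * σ l = 1) (hm : m * σ m = 1)
    (A B C : Matrix (Fin n) (Fin n) R) (hA : A = circ n l a) (hB : B = circ n l b)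
    (hC : C = circ n m c) (J : Matrix (Fin n) (Fin n) R) (hJ : J = exch R n)
    (X : Matrix (Fin n ⊕ Fin n) (Fin n ⊕ Fin n) R)
    (hX : X = Matrix.fromBlocks (-(Aᵀ * C * J)) (-(B.map σ)) (Bᵀ * C * J) (-(A.map σ))) :
    X * (X.map σ)ᵀ = -1
      ↔ (Theta n a (fun i => σ (a i)) 0 (σ l) + Theta n b (fun i => σ (b i)) 0 (σ l) = -1
          ∧ (∀ j, 1 ≤ j → j ≤ n / 2 →
              Theta n a (fun i => σ (a i)) j (σ l) + Theta n b (fun i => σ (b i)) j (σ l) = 0)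
          ∧ Theta n c (fun i => σ (c i)) 0 (σ m) = 1
          ∧ ∀ j, 1 ≤ j → j ≤ n / 2 → Theta n c (fun i => σ (c i)) j (σ m) = 0) := by
  have hn' : 0 < n := hn
  have pA : Commute (shiftP n l) A := by rw [hA]; exact circ_comm_shiftP n l a
  have pB : Commute (shiftP n l) B := by rw [hB]; exact circ_comm_shiftP n l b
  have pC : Commute (shiftP n m) C := by rw [hC]; exact circ_comm_shiftP n m c
  have sA := comm_star n σ l hl A pA
  have sB := comm_star n σ l hl B pB
  have sC := comm_star n σ m hm C pC
  have madd : ∀ M N : Matrix (Fin n) (Fin n) R, ((M + N).map σ)ᵀ = (M.map σ)ᵀ + (N.map σ)ᵀ := by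
    intro M N; ext i j; simp
  have mneg : ∀ M : Matrix (Fin n) (Fin n) R, ((-M).map σ)ᵀ = -(M.map σ)ᵀ := by
    intro M; ext i j; simp
  have mone : ((1 : Matrix (Fin n) (Fin n) R).map σ)ᵀ = 1 := by
    rw [Matrix.map_one _ (map_zero σ) (map_one σ), Matrix.transpose_one]
  rw [block_iff σ hσ n A B C J (comm_of_comm n hn' l _ _ sA pA)
    (comm_of_comm n hn' l _ _ sA pB) (comm_of_comm n hn' l _ _ sB pB)
    (by rw [hJ]; exact exch_star n σ) (by rw [hJ]; exact exch_mul n) X hX]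
  have e1 := herm_zero_iff n hn' σ l hl (A * (A.map σ)ᵀ + B * (B.map σ)ᵀ + 1)
    (((pA.mul_right sA).add_right (pB.mul_right sB)).add_right (Commute.one_right _))
    (by rw [madd, madd, sstar_mul, sstar_mul, sstar_star n σ hσ, sstar_star n σ hσ, mone])
  have e2 := herm_zero_iff n hn' σ m hm (C * (C.map σ)ᵀ + -1)
    ((pC.mul_right sC).add_right (Commute.one_right _).neg_right)
    (by rw [madd, sstar_mul, sstar_star n σ hσ, mneg, mone])
  rw [← eq_neg_iff_add_eq_zero] at e1
  rw [← eq_neg_iff_add_eq_zero, neg_neg] at e2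
  rw [e1, e2, hA, hB, hC, and_assoc]
  simp only [Matrix.add_apply, Matrix.neg_apply, circ_row_theta, Matrix.one_apply_eq]
  refine and_congr eq_neg_iff_add_eq_zero.symm (and_congr ?_ (and_congr ?_ ?_))
  · refine forall_congr' fun j => forall_congr' fun h1 => forall_congr' fun h2 => ?_
    rw [Matrix.one_apply_ne (by intro h; rw [Fin.mk.injEq] at h; omega), add_zero]
  · rw [← eq_neg_iff_add_eq_zero, neg_neg]
  · refine forall_congr' fun j => forall_congr' fun h1 => forall_congr' fun h2 => ?_
    rw [Matrix.one_apply_ne (by intro h; rw [Fin.mk.injEq] at h; omega), neg_zero, add_zero]
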